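/- Let 𝒜 be a central essential arrangement of d hyperplanes in ℂ³, and let H ∉ 𝒜 be a hyperplane that is combinatorially generic with respect to 𝒜 (i.e., H meets the arrangement only in double points of the projective line arrangement, so that |𝒜^H| = d for 𝓑 = 𝒜 ∪ {H}). Then for any minimal homogeneous generating set θ_E, θ₂, …, θ_s of D(𝒜), one has θ_i(α_H) ∉ S·α_H for all 2 ≤ i ≤ s; equivalently, none of θ₂,…,θ_s lies in D(𝓑). -/

import Mathlib

open MvPolynomial

noncomputable section

/-- The polynomial ring `S = ℂ[x₁,…,x_ℓ]`. -/
abbrev PS (ℓ : ℕ) : Type := MvPolynomial (Fin ℓ) ℂ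

/-- The module of ℂ-derivations of `S`. -/
abbrev Der (ℓ : ℕ) : Type := Derivation ℂ (PS ℓ) (PS ℓ)

/-- The logarithmic derivation module of a set of defining forms in a ℂ-algebra. -/
def logDer {R : Type} [CommRing R] [Algebra ℂ R] (A : Set R) :
    Submodule R (Derivation ℂ R R) where
  carrier := {θ | ∀ α ∈ A, θ α ∈ Ideal.span {α}}
  add_mem' := fun ha hb α hα => by simpa using add_mem (ha α hα) (hb α hα)
  zero_mem' := fun α hα => by simp
  smul_mem' := fun c θ h α hα => by simpa using Ideal.mul_mem_left _ c (h α hα)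

/-- The submodule `D₀` of derivations annihilating every defining form. -/
def logDer0 {R : Type} [CommRing R] [Algebra ℂ R] (A : Set R) :
    Submodule R (Derivation ℂ R R) where
  carrier := {θ | ∀ α ∈ A, θ α = 0}
  add_mem' := fun ha hb α hα => by simp [Set.mem_setOf_eq] at *; simp [ha α hα, hb α hα]
  zero_mem' := fun α hα => by simp
  smul_mem' := fun c θ h α hα => by simp [Set.mem_setOf_eq] at *; simp [h α hα]

/-- The Euler derivation `Σ xᵢ ∂ᵢ`. -/
def euler (ℓ : ℕ) : Der ℓ := mkDerivation ℂ (fun i : Fin ℓ => X i)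

/-- A derivation is homogeneous of (polynomial) degree `d` if it sends every variable to a
homogeneous polynomial of degree `d`. -/
def IsHomogDer {ℓ : ℕ} (θ : Der ℓ) (d : ℕ) : Prop := ∀ i, (θ (X i)).IsHomogeneous d

/-- A (nonzero) linear form. -/
def IsLinForm {ℓ : ℕ} (α : PS ℓ) : Prop := α.IsHomogeneous 1 ∧ α ≠ 0

/-- A minimal generating family of the logarithmic derivation module of `A`. -/
def IsMinGen {R : Type} [CommRing R] [Algebra ℂ R] (A : Set R) {s : ℕ}
    (θ : Fin s → Derivation ℂ R R) : Prop :=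
  Submodule.span R (Set.range θ) = logDer A ∧
    ∀ i, θ i ∉ Submodule.span R (θ '' {j | j ≠ i})

/-- A minimal generating family of `D₀(A)`. -/
def IsMinGen0 {R : Type} [CommRing R] [Algebra ℂ R] (A : Set R) {s : ℕ}
    (θ : Fin s → Derivation ℂ R R) : Prop :=
  Submodule.span R (Set.range θ) = logDer0 A ∧
    ∀ i, θ i ∉ Submodule.span R (θ '' {j | j ≠ i})

/-- `exp(A) = M`:  the multiset of degrees of a minimal homogeneous generating family
of `D(A)` is `M`. -/
def HasExp {ℓ : ℕ} (A : Set (PS ℓ)) (M : Multiset ℕ) : Prop :=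
  ∃ (s : ℕ) (θ : Fin s → Der ℓ) (d : Fin s → ℕ),
    (∀ i, IsHomogDer (θ i) (d i)) ∧ IsMinGen A θ ∧ M = Multiset.map d Finset.univ.val

/-- `exp₀(A) = M`: the multiset of degrees of a minimal homogeneous generating family
of `D₀(A)` is `M`. -/
def HasExp0 {ℓ : ℕ} (A : Set (PS ℓ)) (M : Multiset ℕ) : Prop :=
  ∃ (s : ℕ) (θ : Fin s → Der ℓ) (d : Fin s → ℕ),
    (∀ i, IsHomogDer (θ i) (d i)) ∧ IsMinGen0 A θ ∧ M = Multiset.map d Finset.univ.val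

/-- The rank of a finite set of linear forms (= codimension of the corresponding flat). -/
def rk {ℓ : ℕ} (B : Finset (PS ℓ)) : ℕ :=
  Module.finrank ℂ (Submodule.span ℂ (B : Set (PS ℓ)))

/-- `H = {α = 0}` is combinatorially generic with respect to the arrangement `A` in `ℂ^m`:
it contains no nonzero flat of `A`, i.e. adding it to any subarrangement raises the rank
until the ambient rank `m` is reached. -/
def CombGeneric {ℓ : ℕ} (α : PS ℓ) (A : Finset (PS ℓ)) (m : ℕ) : Prop :=
  ∀ B ⊆ A, rk (insert α B) = min (rk B + 1) m

/-- Two arrangements have the same combinatorics (isomorphic intersection lattices):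
there is a bijection of the hyperplanes preserving the rank of every subarrangement. -/
def SameComb {ℓ ℓ' : ℕ} (A₁ : Finset (PS ℓ)) (A₂ : Finset (PS ℓ')) : Prop :=
  ∃ e : PS ℓ → PS ℓ', Set.BijOn e A₁ A₂ ∧
    ∀ B ⊆ A₁, rk (B.image e) = rk B

/-- The number of hyperplanes of the restriction of `A` to `{α = 0}`: the number of
proportionality classes of the (nonzero) images of the forms of `A` in `S/(α)`. -/
def nRes {ℓ : ℕ} (α : PS ℓ) (A : Finset (PS ℓ)) : ℕ :=
  letI : DecidableEq (Submodule ℂ (PS ℓ ⧸ Ideal.span {α})) := Classical.decEq _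
  (A.image fun β =>
    Submodule.span ℂ {Ideal.Quotient.mk (Ideal.span {α}) β}).card

end

noncomputable section

section LinearForms

variable {ℓ : ℕ}

theorem linearForm_eq_sum {β : PS ℓ} (hβ : β.IsHomogeneous 1) :
    ∃ b : Fin ℓ → ℂ, β = ∑ k, C (b k) * X k := by
  have h : β ∈ homogeneousSubmodule (Fin ℓ) ℂ 1 := hβ
  rw [homogeneousSubmodule_one_eq_span_X, Submodule.mem_span_range_iff_exists_fun] at h
  obtain ⟨b, rfl⟩ := h
  exact ⟨b, by simp [smul_eq_C_mul]⟩

/-- The constant derivation in the direction `w`. -/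
def constDer (w : Fin ℓ → ℂ) : Der ℓ := mkDerivation ℂ fun k => C (w k)

theorem constDer_apply (w : Fin ℓ → ℂ) {β : PS ℓ} (hβ : β.IsHomogeneous 1) :
    constDer w β = C (eval w β) := by
  obtain ⟨b, rfl⟩ := linearForm_eq_sum hβ
  simp [constDer, mkDerivation_X, mul_comm]

theorem euler_apply {β : PS ℓ} (hβ : β.IsHomogeneous 1) : euler ℓ β = β := by
  obtain ⟨b, rfl⟩ := linearForm_eq_sum hβ
  simp [euler, mkDerivation_X]

/-- A basis of the linear forms has a dual basis of vectors. -/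
theorem exists_dual {v : Fin ℓ → PS ℓ} (hv : ∀ i, (v i).IsHomogeneous 1)
    (hli : LinearIndependent ℂ v) :
    ∃ w : Fin ℓ → Fin ℓ → ℂ, (∀ i j, eval (w j) (v i) = if i = j then 1 else 0) ∧
      ∀ k, X k = ∑ i, C (w i k) * v i := by
  choose b hb using fun i => linearForm_eq_sum (hv i)
  have hbli : LinearIndependent ℂ b := by
    rw [Fintype.linearIndependent_iff] at hli ⊢
    intro g hg
    apply hli
    simp only [hb, Finset.smul_sum, smul_eq_C_mul]
    rw [Finset.sum_comm]
    refine Finset.sum_eq_zero fun k _ => ?_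
    have := congrFun hg k
    simp only [Finset.sum_apply, Pi.smul_apply, smul_eq_mul, Pi.zero_apply] at this
    simp only [← mul_assoc, ← C_mul, ← Finset.sum_mul, ← map_sum, this, map_zero, zero_mul]
  set B : Matrix (Fin ℓ) (Fin ℓ) ℂ := Matrix.of b
  have hB : IsUnit B := Matrix.linearIndependent_rows_iff_isUnit.mp hbli
  have hdet : IsUnit B.det := (Matrix.isUnit_iff_isUnit_det B).mp hB
  refine ⟨fun j k => B⁻¹ k j, fun i j => ?_, fun k => ?_⟩
  · have := congrFun (congrFun (B.mul_nonsing_inv hdet) i) j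
    rw [Matrix.mul_apply, Matrix.one_apply] at this
    rw [← this, hb]
    simp [B]
  · have h (m) := congrFun (congrFun (B.nonsing_inv_mul hdet) k) m
    simp only [Matrix.mul_apply, Matrix.one_apply] at h
    simp only [hb, Finset.mul_sum]
    rw [Finset.sum_comm]
    simp only [← mul_assoc, ← C_mul, ← Finset.sum_mul, ← map_sum]
    simp only [B, Matrix.of_apply] at h ⊢
    simp [h]

/-- A derivation in terms of a basis of linear forms and its dual basis. -/
theorem derivation_eq_sum_constDer {v : Fin ℓ → PS ℓ} {w : Fin ℓ → Fin ℓ → ℂ}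
    (hw : ∀ k, X k = ∑ i, C (w i k) * v i) (θ : Der ℓ) :
    θ = ∑ i, θ (v i) • constDer (w i) := by
  refine derivation_ext fun k => ?_
  conv_lhs => rw [hw k]
  rw [← Derivation.coeFnAddMonoidHom_apply (∑ i, θ (v i) • constDer (w i)), map_sum]
  simp [constDer, mkDerivation_X, mul_comm]

/-- Forgetting the coordinates in `J`: substituting `0` for the forms `v j`, `j ∈ J`. -/
def killCoords (v : Fin ℓ → PS ℓ) (w : Fin ℓ → Fin ℓ → ℂ) (J : Finset (Fin ℓ)) :
    PS ℓ →ₐ[ℂ] PS ℓ :=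
  aeval fun k => ∑ j ∈ Jᶜ, C (w j k) * v j

theorem killCoords_linearForm (v : Fin ℓ → PS ℓ) (w : Fin ℓ → Fin ℓ → ℂ) (J : Finset (Fin ℓ))
    {β : PS ℓ} (hβ : β.IsHomogeneous 1) :
    killCoords v w J β = ∑ j ∈ Jᶜ, C (eval (w j) β) * v j := by
  obtain ⟨b, rfl⟩ := linearForm_eq_sum hβ
  simp only [killCoords, map_sum, map_mul, aeval_X, eval_C, eval_X, algHom_C, algebraMap_eq,
    Finset.mul_sum, Finset.sum_mul]
  rw [Finset.sum_comm]
  simp only [mul_assoc]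

theorem killCoords_apply {v : Fin ℓ → PS ℓ} (hv : ∀ i, (v i).IsHomogeneous 1)
    {w : Fin ℓ → Fin ℓ → ℂ} (hw : ∀ i j, eval (w j) (v i) = if i = j then 1 else 0)
    (J : Finset (Fin ℓ)) (i : Fin ℓ) :
    killCoords v w J (v i) = if i ∈ J then 0 else v i := by
  rw [killCoords_linearForm v w J (hv i)]
  by_cases h : i ∈ J <;> simp [hw, h, ite_mul]

theorem ker_killCoords {v : Fin ℓ → PS ℓ} (hv : ∀ i, (v i).IsHomogeneous 1)
    {w : Fin ℓ → Fin ℓ → ℂ} (hw : ∀ i j, eval (w j) (v i) = if i = j then 1 else 0)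
    (hX : ∀ k, X k = ∑ i, C (w i k) * v i) (J : Finset (Fin ℓ)) :
    RingHom.ker (killCoords v w J) = Ideal.span (v '' J) := by
  set I := Ideal.span (v '' (J : Set (Fin ℓ)))
  apply le_antisymm
  · intro p hp
    have key : (Ideal.Quotient.mkₐ ℂ I).comp (killCoords v w J) = Ideal.Quotient.mkₐ ℂ I := by
      refine algHom_ext fun k => ?_
      simp only [AlgHom.comp_apply, Ideal.Quotient.mkₐ_eq_mk]
      rw [eq_comm, Ideal.Quotient.eq]
      simp only [killCoords, aeval_X]
      rw [hX k, ← Finset.sum_add_sum_compl J, add_sub_cancel_right]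
      exact sum_mem fun j hj => Ideal.mul_mem_left _ _ (Ideal.subset_span ⟨j, hj, rfl⟩)
    have := DFunLike.congr_fun key p
    rw [RingHom.mem_ker] at hp
    simp only [AlgHom.comp_apply, hp, map_zero, Ideal.Quotient.mkₐ_eq_mk] at this
    exact Ideal.Quotient.eq_zero_iff_mem.mp this.symm
  · rw [Ideal.span_le]
    rintro _ ⟨j, hj, rfl⟩
    have hj' : j ∈ J := hj
    simp [RingHom.mem_ker, killCoords_apply hv hw, hj']

/-- Linearly independent linear forms generate a prime ideal, not containing the others. -/
theorem isPrime_span_image {v : Fin ℓ → PS ℓ} (hv : ∀ i, (v i).IsHomogeneous 1)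
    (hli : LinearIndependent ℂ v) (J : Finset (Fin ℓ)) :
    (Ideal.span (v '' J)).IsPrime ∧ ∀ i ∉ J, v i ∉ Ideal.span (v '' J) := by
  obtain ⟨w, hw, hX⟩ := exists_dual hv hli
  rw [← ker_killCoords hv hw hX J]
  refine ⟨RingHom.ker_isPrime _, fun i hi h => hli.ne_zero i ?_⟩
  rw [RingHom.mem_ker, killCoords_apply hv hw, if_neg hi] at h
  exact h

end LinearForms

theorem isHomogeneous_triple {a b c : PS 3} (ha : a.IsHomogeneous 1) (hb : b.IsHomogeneous 1)
    (hc : c.IsHomogeneous 1) (i : Fin 3) : (![a, b, c] i).IsHomogeneous 1 := by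
  fin_cases i
  exacts [ha, hb, hc]

theorem isPrime_span_single {a b c : PS 3} (ha : a.IsHomogeneous 1) (hb : b.IsHomogeneous 1)
    (hc : c.IsHomogeneous 1) (hli : LinearIndependent ℂ ![a, b, c]) :
    (Ideal.span {a}).IsPrime ∧ b ∉ Ideal.span {a} := by
  have h := isPrime_span_image (isHomogeneous_triple ha hb hc) hli {0}
  simp only [Finset.coe_singleton, Set.image_singleton, Matrix.cons_val_zero] at h
  exact ⟨h.1, h.2 1 (by decide)⟩

theorem isPrime_span_pair {a b c : PS 3} (ha : a.IsHomogeneous 1) (hb : b.IsHomogeneous 1)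
    (hc : c.IsHomogeneous 1) (hli : LinearIndependent ℂ ![a, b, c]) :
    (Ideal.span {a, b}).IsPrime ∧ c ∉ Ideal.span {a, b} := by
  have h := isPrime_span_image (isHomogeneous_triple ha hb hc) hli {0, 1}
  simp only [Finset.coe_insert, Finset.coe_singleton, Set.image_pair, Matrix.cons_val_zero,
    Matrix.cons_val_one] at h
  exact ⟨h.1, h.2 2 (by decide)⟩

theorem exists_dual_triple {a b c : PS 3} (ha : a.IsHomogeneous 1) (hb : b.IsHomogeneous 1)
    (hc : c.IsHomogeneous 1) (hli : LinearIndependent ℂ ![a, b, c]) :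
    ∃ u v w : Fin 3 → ℂ,
      (eval u a = 1 ∧ eval u b = 0 ∧ eval u c = 0) ∧
      (eval v a = 0 ∧ eval v b = 1 ∧ eval v c = 0) ∧
      (eval w a = 0 ∧ eval w b = 0 ∧ eval w c = 1) ∧
      ∀ θ : Der 3, θ = θ a • constDer u + θ b • constDer v + θ c • constDer w := by
  obtain ⟨w, hw, hX⟩ := exists_dual (isHomogeneous_triple ha hb hc) hli
  refine ⟨w 0, w 1, w 2, ⟨?_, ?_, ?_⟩, ⟨?_, ?_, ?_⟩, ⟨?_, ?_, ?_⟩, fun θ => ?_⟩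
  · simpa using hw 0 0
  · simpa using hw 1 0
  · simpa using hw 2 0
  · simpa using hw 0 1
  · simpa using hw 1 1
  · simpa using hw 2 1
  · simpa using hw 0 2
  · simpa using hw 1 2
  · simpa using hw 2 2
  · conv_lhs => rw [derivation_eq_sum_constDer hX θ]
    simp [Fin.sum_univ_three]

/-- An element of `R/(α)` divisible by several distinct primes is divisible by their product. -/
theorem exists_eq_mul_prod_add {R : Type*} [CommRing R] {α p : R} (T : Finset R)
    (hprime : ∀ β ∈ T, (Ideal.span {α, β}).IsPrime)
    (hne : ∀ β ∈ T, ∀ β' ∈ T, β ≠ β' → β' ∉ Ideal.span {α, β})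
    (hp : ∀ β ∈ T, p ∈ Ideal.span {α, β}) :
    ∃ h q, p = h * ∏ β ∈ T, β + α * q := by
  classical
  induction T using Finset.induction_on with
  | empty => exact ⟨p, 0, by simp⟩
  | insert β T hβ ih =>
    obtain ⟨h, q, hpq⟩ := ih (fun b hb => hprime b (Finset.mem_insert_of_mem hb))
      (fun b hb b' hb' => hne b (Finset.mem_insert_of_mem hb) b' (Finset.mem_insert_of_mem hb'))
      (fun b hb => hp b (Finset.mem_insert_of_mem hb))
    have hβT := Finset.mem_insert_self β T
    have hP := hprime β hβT
    have hmem : h * ∏ b ∈ T, b ∈ Ideal.span {α, β} := by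
      have : h * ∏ b ∈ T, b = p - α * q := by rw [hpq]; ring
      rw [this]
      exact sub_mem (hp β hβT) (Ideal.mul_mem_right _ _ (Ideal.subset_span (by simp)))
    have hh : h ∈ Ideal.span {α, β} := by
      refine (hP.mem_or_mem hmem).resolve_right fun hT => ?_
      obtain ⟨b, hb, hbm⟩ := (hP.prod_mem_iff).mp hT
      exact hne β hβT b (Finset.mem_insert_of_mem hb) (fun e => hβ (e ▸ hb)) hbm
    obtain ⟨x, y, rfl⟩ := Ideal.mem_span_pair.mp hh
    refine ⟨y, x * ∏ b ∈ T, b + q, ?_⟩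
    rw [hpq, Finset.prod_insert hβ]
    ring

/-- One form for each hyperplane of an arrangement. -/
theorem exists_representatives {ℓ : ℕ} (A : Finset (PS ℓ)) (hA : ∀ β ∈ A, IsLinForm β) :
    ∃ A₀ ⊆ A, (∀ β ∈ A₀, ∀ β' ∈ A₀, β ≠ β' → LinearIndependent ℂ ![β, β']) ∧
      ∀ β ∈ A, ∃ β' ∈ A₀, ∃ z : ℂˣ, z • β' = β := by
  classical
  obtain ⟨s, hsA, hs⟩ := Set.exists_subset_bijOn (A : Set (PS ℓ))
    (fun β => Submodule.span ℂ {β})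
  have hfin : s.Finite := A.finite_toSet.subset hsA
  refine ⟨hfin.toFinset, by simpa using hsA, fun β hβ β' hβ' hne => ?_, fun β hβ => ?_⟩
  · simp only [Set.Finite.mem_toFinset] at hβ hβ'
    have h0 := (hA β (hsA hβ)).2
    have h0' := (hA β' (hsA hβ')).2
    rw [LinearIndependent.pair_iff' h0]
    intro z hz
    have hz0 : z ≠ 0 := by rintro rfl; exact h0' (by simpa using hz.symm)
    refine hne (hs.injOn hβ hβ' ?_)
    exact Submodule.span_singleton_eq_span_singleton.mpr ⟨Units.mk0 z hz0, hz⟩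
  · obtain ⟨β', hβ', h⟩ := hs.surjOn ⟨β, hβ, rfl⟩
    exact ⟨β', by simpa using hβ', Submodule.span_singleton_eq_span_singleton.mp h⟩

theorem mem_logDer_of_representatives {ℓ : ℕ} {A A₀ : Finset (PS ℓ)}
    (hrep : ∀ β ∈ A, ∃ β' ∈ A₀, ∃ z : ℂˣ, z • β' = β) {θ : Der ℓ}
    (hθ : ∀ β ∈ A₀, θ β ∈ Ideal.span {β}) : θ ∈ logDer (A : Set (PS ℓ)) := by
  intro β hβ
  obtain ⟨β', hβ', z, rfl⟩ := hrep β hβ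
  obtain ⟨q, hq⟩ := Ideal.mem_span_singleton'.mp (hθ β' hβ')
  refine Ideal.mem_span_singleton'.mpr ⟨q, ?_⟩
  simp only [Units.smul_def, Derivation.map_smul, ← hq, mul_smul_comm]

theorem exists_notMem_span {ℓ : ℕ} {A : Finset (PS ℓ)} (s : Finset (PS ℓ))
    (h : s.card < rk A) : ∃ β ∈ A, β ∉ Submodule.span ℂ (s : Set (PS ℓ)) := by
  by_contra! hc
  have h1 : Submodule.span ℂ (A : Set (PS ℓ)) ≤ Submodule.span ℂ (s : Set (PS ℓ)) :=
    Submodule.span_le.mpr hc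
  have h2 := Submodule.finrank_mono h1
  have h3 := finrank_span_finset_le_card (R := ℂ) s
  exact absurd (h2.trans h3) (not_le.mpr h)

theorem exists_pair_linearIndependent {A : Finset (PS 3)} (hess : rk A = 3) {β : PS 3}
    (hβ : β ≠ 0) : ∃ β₁ ∈ A, LinearIndependent ℂ ![β, β₁] := by
  obtain ⟨β₁, hβ₁, h₁⟩ := exists_notMem_span (A := A) {β} (by simp [hess])
  refine ⟨β₁, hβ₁, (LinearIndependent.pair_iff' hβ).mpr fun z hz => h₁ ?_⟩
  simpa using Submodule.mem_span_singleton.mpr ⟨z, hz⟩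

theorem exists_triple_linearIndependent {A : Finset (PS 3)} (hess : rk A = 3) {β : PS 3}
    (hβ : β ≠ 0) : ∃ β₁ ∈ A, ∃ β₂ ∈ A, LinearIndependent ℂ ![β, β₁, β₂] := by
  classical
  obtain ⟨β₁, hβ₁, h₁⟩ := exists_pair_linearIndependent hess hβ
  obtain ⟨β₂, hβ₂, h₂⟩ := exists_notMem_span (A := A) {β, β₁}
    (by have := Finset.card_le_two (a := β) (b := β₁); omega)
  refine ⟨β₁, hβ₁, β₂, hβ₂, ?_⟩
  have hrange : Set.range ![β, β₁] = (({β, β₁} : Finset (PS 3)) : Set (PS 3)) := by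
    simp [Matrix.range_cons, Set.pair_comm]
  have h := (linearIndependent_finSnoc (v := ![β, β₁]) (x := β₂)).mpr ⟨h₁, hrange ▸ h₂⟩
  have hsnoc : (Fin.snoc ![β, β₁] β₂ : Fin 3 → PS 3) = ![β, β₁, β₂] := by
    ext1 i
    fin_cases i <;> rfl
  rwa [hsnoc] at h

theorem CombGeneric.linearIndependent {A : Finset (PS 3)} {α β β' : PS 3}
    (hgen : CombGeneric α A 3) (hβ : β ∈ A) (hβ' : β' ∈ A)
    (h : LinearIndependent ℂ ![β, β']) : LinearIndependent ℂ ![α, β, β'] := by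
  classical
  have h2 : rk ({β, β'} : Finset (PS 3)) = 2 := by
    have hrange : (({β, β'} : Finset (PS 3)) : Set (PS 3)) = Set.range ![β, β'] := by
      simp [Matrix.range_cons, Set.pair_comm]
    rw [rk, hrange, finrank_span_eq_card h, Fintype.card_fin]
  have h3 := hgen {β, β'} (by simp [Finset.insert_subset_iff, hβ, hβ'])
  have hrange : ((insert α {β, β'} : Finset (PS 3)) : Set (PS 3)) = Set.range ![α, β, β'] := by
    ext
    simp only [Finset.coe_insert, Finset.coe_singleton, Set.mem_insert_iff,
      Set.mem_singleton_iff, Matrix.range_cons, Matrix.range_empty, Set.union_empty,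
      Set.singleton_union]
  rw [h2, rk, hrange] at h3
  rw [linearIndependent_iff_card_eq_finrank_span, Set.finrank, h3, Fintype.card_fin]
  rfl

/-- If `v` is killed by `β₀`, then `(Q / β₀) ∂_v` is a combination of logarithmic derivations
with coefficients without constant term, where `Q` is the defining polynomial. -/
theorem prod_smul_constDer_mem {A A₀ : Finset (PS 3)} (hA : ∀ β ∈ A, IsLinForm β)
    (hsub : A₀ ⊆ A) (hrep : ∀ β ∈ A, ∃ β' ∈ A₀, ∃ z : ℂˣ, z • β' = β) {β₀ β₁ β₂ : PS 3}
    (h₀ : β₀ ∈ A₀) (h₁ : β₁ ∈ A₀) (h₂ : β₂ ∈ A₀) (hli : LinearIndependent ℂ ![β₀, β₁, β₂])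
    {v : Fin 3 → ℂ} (hv : eval v β₀ = 0) [DecidableEq (PS 3)] :
    (∏ β ∈ A₀.erase β₀, β) • constDer v ∈
      RingHom.ker (constantCoeff (R := ℂ) (σ := Fin 3)) • logDer (A : Set (PS 3)) := by
  have hlin (β) (h : β ∈ A₀) : β.IsHomogeneous 1 := (hA β (hsub h)).1
  have hcc (β) (h : β ∈ A₀) : β ∈ RingHom.ker (constantCoeff (R := ℂ) (σ := Fin 3)) := by
    rw [RingHom.mem_ker, constantCoeff_eq]
    exact (hlin β h).coeff_eq_zero (by simp)
  have key (β' : PS 3) (h' : β' ∈ A₀.erase β₀) (u : Fin 3 → ℂ) (hu0 : eval u β₀ = 0)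
      (hu : eval u β' = 0) (c : ℂ) : (∏ β ∈ A₀.erase β₀, β) • (C c : PS 3) • constDer u ∈
      RingHom.ker (constantCoeff (R := ℂ) (σ := Fin 3)) • logDer (A : Set (PS 3)) := by
    rw [← Finset.mul_prod_erase _ _ h', mul_smul]
    refine Submodule.smul_mem_smul (hcc β' (Finset.mem_of_mem_erase h')) ?_
    refine mem_logDer_of_representatives hrep fun β hβ => ?_
    rw [Derivation.smul_apply, Derivation.smul_apply, constDer_apply u (hlin β hβ)]
    by_cases e0 : β = β₀
    · simp [e0, hu0]
    by_cases e : β = β'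
    · simp [e, hu]
    rw [Ideal.mem_span_singleton]
    exact Dvd.dvd.mul_right (Finset.dvd_prod_of_mem _
      (Finset.mem_erase.mpr ⟨e, Finset.mem_erase.mpr ⟨e0, hβ⟩⟩)) _
  obtain ⟨u₀, u₁, u₂, hu₀, hu₁, hu₂, hθ⟩ :=
    exists_dual_triple (hlin _ h₀) (hlin _ h₁) (hlin _ h₂) hli
  have ne₁ : β₁ ≠ β₀ := fun e =>
    hli.injective.ne (show (0 : Fin 3) ≠ 1 by decide) (by simp [e])
  have ne₂ : β₂ ≠ β₀ := fun e =>
    hli.injective.ne (show (0 : Fin 3) ≠ 2 by decide) (by simp [e])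
  rw [hθ (constDer v), constDer_apply v (hlin _ h₀), constDer_apply v (hlin _ h₁),
    constDer_apply v (hlin _ h₂), hv, map_zero, zero_smul, zero_add, smul_add]
  exact add_mem (key β₂ (Finset.mem_erase.mpr ⟨ne₂, h₂⟩) u₁ hu₁.1 hu₁.2.2 _)
    (key β₁ (Finset.mem_erase.mpr ⟨ne₁, h₁⟩) u₂ hu₂.1 hu₂.2.1 _)

/-- A logarithmic derivation that is also logarithmic along a generic plane is, up to a multiple
of the Euler derivation, a combination of logarithmic derivations with coefficients without
constant term. -/
theorem exists_sub_smul_euler_mem (A : Finset (PS 3)) (hA : ∀ β ∈ A, IsLinForm β)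
    (hess : rk A = 3) (α : PS 3) (hαlin : IsLinForm α) (hgen : CombGeneric α A 3)
    (θ : Der 3) (hθ : θ ∈ logDer (A : Set (PS 3))) (hθα : θ α ∈ Ideal.span {α}) :
    ∃ k : PS 3, θ - k • euler 3 ∈
      RingHom.ker (constantCoeff (R := ℂ) (σ := Fin 3)) • logDer (A : Set (PS 3)) := by
  classical
  obtain ⟨A₀, hsub, hpair, hrep⟩ := exists_representatives A hA
  have hlin (β) (h : β ∈ A₀) : β.IsHomogeneous 1 := (hA β (hsub h)).1
  have hne0 (β) (h : β ∈ A₀) : β ≠ 0 := (hA β (hsub h)).2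
  have hess₀ : rk A₀ = 3 := by
    have hspan : Submodule.span ℂ (A₀ : Set (PS 3)) = Submodule.span ℂ (A : Set (PS 3)) := by
      refine le_antisymm (Submodule.span_mono (by simpa using hsub)) (Submodule.span_le.mpr ?_)
      intro β hβ
      obtain ⟨β', hβ', z, rfl⟩ := hrep β hβ
      exact Submodule.smul_mem _ (z : ℂ) (Submodule.subset_span hβ')
    rwa [rk, hspan]
  obtain ⟨β₀, h₀, -⟩ := exists_notMem_span (A := A₀) ∅ (by simp [hess₀])
  obtain ⟨β₁, h₁, β₂, h₂, hli⟩ := exists_triple_linearIndependent hess₀ (hne0 β₀ h₀)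
  have hli₀₁ : LinearIndependent ℂ ![β₀, β₁] := by
    have := hli.comp ![0, 1] (by decide)
    convert this using 1
    ext1 i
    fin_cases i <;> rfl
  have hα₀₁ := hgen.linearIndependent (hsub h₀) (hsub h₁) hli₀₁
  obtain ⟨u, u₀, v, hu, hu₀, hv, hdual⟩ :=
    exists_dual_triple hαlin.1 (hlin _ h₀) (hlin _ h₁) hα₀₁
  obtain ⟨f, hf⟩ := Ideal.mem_span_singleton'.mp hθα
  obtain ⟨k, hk⟩ := Ideal.mem_span_singleton'.mp (hθ β₀ (hsub h₀))
  set p := θ β₁ - k * β₁ with hp_def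
  have hdecomp : θ - k • euler 3 = ((f - k) * α) • constDer u + p • constDer v := by
    rw [hdual (θ - k • euler 3)]
    simp only [Derivation.sub_apply, Derivation.smul_apply, euler_apply hαlin.1,
      euler_apply (hlin _ h₀), euler_apply (hlin _ h₁), smul_eq_mul, ← hf, ← hk, sub_self,
      zero_smul, add_zero, ← sub_mul, hp_def]
  have hpβ (β) (hβ : β ∈ A₀.erase β₀) : p ∈ Ideal.span {α, β} := by
    obtain ⟨hne, hβ⟩ := Finset.mem_erase.mp hβ
    have hliβ := hgen.linearIndependent (hsub h₀) (hsub hβ) (hpair _ h₀ _ hβ hne.symm)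
    have hvβ : eval v β ≠ 0 := fun h0 => by
      obtain ⟨u', v', w', hu', hv', hw', hd⟩ :=
        exists_dual_triple hαlin.1 (hlin _ h₀) (hlin _ hβ) hliβ
      have h := congrArg (fun D : Der 3 => D β₁) (hd (constDer v))
      simp [constDer_apply v hαlin.1, constDer_apply v (hlin _ h₀), constDer_apply v (hlin _ h₁),
        constDer_apply v (hlin _ hβ), hv, h0] at h
    obtain ⟨q, hq⟩ := Ideal.mem_span_singleton'.mp (hθ β (hsub hβ))
    have h := congrArg (fun D : Der 3 => D β) hdecomp
    simp only [Derivation.sub_apply, Derivation.smul_apply, Derivation.add_apply,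
      euler_apply (hlin _ hβ), constDer_apply u (hlin _ hβ), constDer_apply v (hlin _ hβ),
      smul_eq_mul, ← hq] at h
    have hCC : C (eval v β) * C (eval v β)⁻¹ = (1 : PS 3) := by
      rw [← C_mul, mul_inv_cancel₀ hvβ, C_1]
    refine Ideal.mem_span_pair.mpr
      ⟨-((f - k) * C (eval u β)) * C (eval v β)⁻¹, (q - k) * C (eval v β)⁻¹, ?_⟩
    linear_combination C (eval v β)⁻¹ * h + p * hCC
  obtain ⟨h, q, hpq⟩ := exists_eq_mul_prod_add (α := α) (p := p) (A₀.erase β₀)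
    (fun β hβ => by
      obtain ⟨hne, hβ⟩ := Finset.mem_erase.mp hβ
      exact (isPrime_span_pair hαlin.1 (hlin _ hβ) (hlin _ h₀)
        (hgen.linearIndependent (hsub hβ) (hsub h₀) (hpair _ hβ _ h₀ hne))).1)
    (fun β hβ β' hβ' hne => by
      have hβ := Finset.mem_of_mem_erase hβ
      have hβ' := Finset.mem_of_mem_erase hβ'
      exact (isPrime_span_pair hαlin.1 (hlin _ hβ) (hlin _ hβ')
        (hgen.linearIndependent (hsub hβ) (hsub hβ') (hpair _ hβ _ hβ' hne))).2) hpβ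
  have hφ := prod_smul_constDer_mem hA hsub hrep h₀ h₁ h₂ hli hv.2.1
  set m := RingHom.ker (constantCoeff (R := ℂ) (σ := Fin 3))
  set η : Der 3 := (f - k) • constDer u + q • constDer v
  have hsplit : θ - k • euler 3 = h • (∏ β ∈ A₀.erase β₀, β) • constDer v + α • η := by
    rw [hdecomp, hpq]
    simp only [η]
    module
  have hαη : α • η ∈ logDer (A : Set (PS 3)) := by
    have hE : euler 3 ∈ logDer (A : Set (PS 3)) := fun β hβ => by
      rw [euler_apply (hA β hβ).1]
      exact Ideal.mem_span_singleton_self β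
    rw [← sub_eq_iff_eq_add'.mpr hsplit]
    exact sub_mem (sub_mem hθ (Submodule.smul_mem _ k hE))
      (Submodule.smul_mem _ h (Submodule.smul_le_right hφ))
  have hη : η ∈ logDer (A : Set (PS 3)) := by
    intro β hβ
    obtain ⟨β', hβ', hβli⟩ := exists_pair_linearIndependent hess (hA β hβ).2
    have hli' := hgen.linearIndependent hβ hβ' hβli
    have hli'' : LinearIndependent ℂ ![β, α, β'] := by
      have := hli'.comp ![1, 0, 2] (by decide)
      convert this using 1
      ext1 i
      fin_cases i <;> rfl
    obtain ⟨hP, hα⟩ := isPrime_span_single (hA β hβ).1 hαlin.1 (hA β' hβ').1 hli''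
    have := hαη β hβ
    rw [Derivation.smul_apply, smul_eq_mul] at this
    exact (hP.mem_or_mem this).resolve_left hα
  refine ⟨k, ?_⟩
  rw [hsplit]
  refine add_mem (Submodule.smul_mem _ h hφ) (Submodule.smul_mem_smul ?_ hη)
  rw [RingHom.mem_ker, constantCoeff_eq]
  exact hαlin.1.coeff_eq_zero (by simp)

theorem homogeneousComponent_mul_of_isHomogeneous {ℓ : ℕ} {p q : PS ℓ} {e : ℕ}
    (hq : q.IsHomogeneous e) (n : ℕ) : homogeneousComponent n (p * q) =
      if e ≤ n then homogeneousComponent (n - e) p * q else 0 := by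
  let _ : GradedAlgebra (homogeneousSubmodule (Fin ℓ) ℂ) := gradedAlgebra
  have hdec (φ : PS ℓ) (i : ℕ) :
      (DirectSum.decompose (homogeneousSubmodule (Fin ℓ) ℂ) φ i : PS ℓ) =
        homogeneousComponent i φ := decomposition.decompose'_apply φ i
  have h := DirectSum.coe_decompose_mul_of_right_mem (homogeneousSubmodule (Fin ℓ) ℂ)
    (a := p) n (show q ∈ homogeneousSubmodule (Fin ℓ) ℂ e from hq)
  rwa [hdec, hdec] at h

/-- Graded Nakayama: a homogeneous element of a homogeneous family that is a combination of the
family, with own coefficient without constant term, is a combination of the others. -/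
theorem mem_span_image_ne {ℓ : ℕ} {ι : Type*} [Fintype ι] (θ : ι → Der ℓ) (d : ι → ℕ)
    (hhom : ∀ i, IsHomogDer (θ i) (d i)) (b : ι → PS ℓ) (i : ι)
    (hb : constantCoeff (b i) = 0) (h : θ i = ∑ j, b j • θ j) :
    θ i ∈ Submodule.span (PS ℓ) (θ '' {j | j ≠ i}) := by
  classical
  set c : ι → PS ℓ := fun j =>
    if d j ≤ d i then homogeneousComponent (d i - d j) (b j) else 0
  have hc : θ i = ∑ j, c j • θ j := by
    refine derivation_ext fun t => ?_
    have ht := congrArg (fun D =>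
      homogeneousComponent (d i) (Derivation.coeFnAddMonoidHom D (X t))) h
    simp only [map_sum, Finset.sum_apply, Derivation.coeFnAddMonoidHom_apply,
      Derivation.smul_apply, smul_eq_mul, homogeneousComponent_mul_of_isHomogeneous (hhom _ t),
      homogeneousComponent_eq_self (hhom i t)] at ht
    rw [ht, ← Derivation.coeFnAddMonoidHom_apply (∑ j, c j • θ j), map_sum]
    simp only [Finset.sum_apply, Derivation.coeFnAddMonoidHom_apply, Derivation.smul_apply,
      smul_eq_mul, c, ite_mul, zero_mul]
  have hci : c i = 0 := by
    simp [c, homogeneousComponent_zero, ← constantCoeff_eq, hb]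
  rw [hc, ← Finset.add_sum_erase _ _ (Finset.mem_univ i), hci, zero_smul, zero_add]
  exact sum_mem fun j hj => Submodule.smul_mem _ _
    (Submodule.subset_span ⟨j, Finset.ne_of_mem_erase hj, rfl⟩)

/-- if `H ∉ 𝒜` is combinatorially generic with respect to an essential
arrangement `𝒜` in `ℂ³`, then for any minimal homogeneous generating set
`θ_E, θ₂, …, θ_s` of `D(𝒜)` one has `θ_i(α_H) ∉ S·α_H` for `i ≥ 2`; equivalently,
none of `θ₂, …, θ_s` lies in `D(𝓑)` for `𝓑 = 𝒜 ∪ {H}`. -/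
theorem generators_not_logarithmic_along_generic {s : ℕ} (A : Finset (PS 3))
    (hA : ∀ β ∈ A, IsLinForm β) (hess : rk A = 3)
    (α : PS 3) (hαlin : IsLinForm α) (hα : α ∉ A)
    (hgen : CombGeneric α A 3)
    (θ : Fin (s + 1) → Der 3) (d : Fin (s + 1) → ℕ)
    (hθE : θ 0 = euler 3)
    (hhom : ∀ i, IsHomogDer (θ i) (d i))
    (hmin : IsMinGen (A : Set (PS 3)) θ) :
    ∀ i : Fin (s + 1), i ≠ 0 →
      θ i α ∉ Ideal.span {α} ∧
      θ i ∉ logDer ((insert α A : Finset (PS 3)) : Set (PS 3)) := by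
  intro i hi
  suffices h : θ i α ∉ Ideal.span {α} from ⟨h, fun h' => h (h' α (by simp))⟩
  intro hθα
  have hspan := hmin.1
  have hmem (j) : θ j ∈ logDer (A : Set (PS 3)) := hspan ▸ Submodule.subset_span ⟨j, rfl⟩
  obtain ⟨k, hk⟩ := exists_sub_smul_euler_mem A hA hess α hαlin hgen (θ i) (hmem i) hθα
  rw [← hspan, Submodule.mem_ideal_smul_span_iff_exists_sum] at hk
  obtain ⟨a, ha, hsum⟩ := hk
  rw [Finsupp.sum_fintype _ _ (by simp), ← hθE] at hsum
  refine hmin.2 i (mem_span_image_ne θ d hhom (fun j => a j + if j = 0 then k else 0) i ?_ ?_)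
  · simpa [hi] using ha i
  · simp only [add_smul, Finset.sum_add_distrib, hsum, ite_smul, zero_smul,
      Finset.sum_ite_eq', Finset.mem_univ, if_true, sub_add_cancel]

end
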